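/- arXiv:1403.6387 — 2 statements merged into one kernel-verified Lean document; each statement's English description precedes it below -/
import Mathlib

section
/- Let n ≥ 1 and let G be a connected simple graph on Fin n with edge set E. For every matrix z ∈ Matrix Q Q ℂ, one has U_{jk} * z * U_{jk} = z for every edge {j,k} ∈ E if and only if U_π * z * U_π† = z for every permutation π of Fin n. -/
open Matrix
/-- The state space of an `n`-qubit register under the standard computational basis:
functions from `Fin n` to `Fin 2`. -/
abbrev Qn (n : ℕ) := Fin n → Fin 2

/-- The permutation matrix `U_π` acting on `Matrix (Qn n) (Qn n) ℂ`:
`(U_π) f g = 1` if `f = g ∘ π` and `0` otherwise. -/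
def permMat {n : ℕ} (π : Equiv.Perm (Fin n)) : Matrix (Qn n) (Qn n) ℂ :=
  Matrix.of fun f g => if f = g ∘ π then 1 else 0

/-- The swapping operator between qubits `j` and `k`. -/
def uSwap {n : ℕ} (j k : Fin n) : Matrix (Qn n) (Qn n) ℂ :=
  permMat (Equiv.swap j k)

/-- The quantum average `P*(z) = (1/n!) Σ_π U_π z U_π†`. -/
noncomputable def pStar {n : ℕ} (z : Matrix (Qn n) (Qn n) ℂ) : Matrix (Qn n) (Qn n) ℂ :=
  ((n.factorial : ℂ))⁻¹ • ∑ π : Equiv.Perm (Fin n), permMat π * z * (permMat π)ᴴ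

/-- The set of edges of `G`, encoded as the ordered pairs `(j, k)` with `j < k`
and `{j,k} ∈ E`; each undirected edge appears exactly once. -/
def edgePairs {n : ℕ} (G : SimpleGraph (Fin n)) [DecidableRel G.Adj] :
    Finset (Fin n × Fin n) :=
  Finset.univ.filter fun p => G.Adj p.1 p.2 ∧ p.1 < p.2

/-- Conjugation by `permMat π` permutes the qubits of both indices by `π⁻¹`. -/
theorem permMat_mul_mul_conjTranspose_apply {n : ℕ} (π : Equiv.Perm (Fin n))
    (z : Matrix (Qn n) (Qn n) ℂ) (f g : Qn n) :
    (permMat π * z * (permMat π)ᴴ) f g = z (f ∘ π.symm) (g ∘ π.symm) := by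
  have key (f h : Qn n) : f = h ∘ π ↔ h = f ∘ π.symm :=
    eq_comm.trans (Equiv.eq_comp_symm π h f).symm
  simp [Matrix.mul_apply, permMat, key, apply_ite (star : ℂ → ℂ)]

/-- `uSwap j k` is Hermitian. -/
theorem conjTranspose_uSwap {n : ℕ} (j k : Fin n) : (uSwap j k)ᴴ = uSwap j k := by
  ext f g
  have key : g = f ∘ Equiv.swap j k ↔ f = g ∘ Equiv.swap j k :=
    eq_comm.trans (Equiv.eq_comp_symm (Equiv.swap j k) f g).symm
  simp [uSwap, permMat, key, apply_ite (star : ℂ → ℂ)]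

/-- The permutations whose simultaneous action on row and column indices fixes `z`. -/
def indexStabilizer {n : ℕ} (z : Matrix (Qn n) (Qn n) ℂ) : Subgroup (Equiv.Perm (Fin n)) where
  carrier := {π | ∀ f g : Qn n, z (f ∘ π) (g ∘ π) = z f g}
  one_mem' _ _ := rfl
  mul_mem' {σ τ} hσ hτ f g := (hτ (f ∘ σ) (g ∘ σ)).trans (hσ f g)
  inv_mem' {σ} hσ f g := by
    simpa [Function.comp_assoc] using (hσ (f ∘ ⇑σ⁻¹) (g ∘ ⇑σ⁻¹)).symm

theorem mem_indexStabilizer_iff {n : ℕ} (z : Matrix (Qn n) (Qn n) ℂ)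
    (π : Equiv.Perm (Fin n)) :
    π ∈ indexStabilizer z ↔ permMat π * z * (permMat π)ᴴ = z := by
  rw [← inv_mem_iff, ← Matrix.ext_iff]
  simp only [permMat_mul_mul_conjTranspose_apply]
  rfl

/-- A subgroup containing the transpositions along the edges of a connected graph is everything. -/
theorem SimpleGraph.Connected.subgroup_eq_top_of_swap_mem {V : Type*} [Finite V] [DecidableEq V]
    {G : SimpleGraph V} (hG : G.Connected) {H : Subgroup (Equiv.Perm V)}
    (h : ∀ j k, G.Adj j k → Equiv.swap j k ∈ H) : H = ⊤ := by
  have hswap (j k : V) : Equiv.swap j k ∈ H := by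
    obtain ⟨p⟩ := hG.preconnected j k
    induction p with
    | nil =>
      rw [Equiv.swap_self]
      exact H.one_mem
    | cons hadj _ ih => exact SubmonoidClass.swap_mem_trans H (h _ _ hadj) ih
  rw [eq_top_iff, ← Equiv.Perm.closure_isSwap, Subgroup.closure_le]
  rintro _ ⟨j, k, -, rfl⟩
  exact hswap j k

/-- for a connected quantum interaction graph `G`,
`U_{jk} z U_{jk} = z` for every edge `{j,k} ∈ E` iff `U_π z U_π† = z` for every
permutation `π` of `Fin n`. -/
theorem edge_fixed_iff_perm_fixed
    (n : ℕ) (hn : 1 ≤ n) (G : SimpleGraph (Fin n)) [DecidableRel G.Adj]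
    (hG : G.Connected) (z : Matrix (Qn n) (Qn n) ℂ) :
    (∀ j k : Fin n, G.Adj j k → uSwap j k * z * uSwap j k = z) ↔
      ∀ π : Equiv.Perm (Fin n), permMat π * z * (permMat π)ᴴ = z := by
  have hedge (j k : Fin n) :
      uSwap j k * z * uSwap j k = z ↔ Equiv.swap j k ∈ indexStabilizer z := by
    rw [mem_indexStabilizer_iff]
    nth_rewrite 2 [← conjTranspose_uSwap]
    rfl
  simp only [hedge, ← mem_indexStabilizer_iff]
  refine ⟨fun h π => ?_, fun h j k _ => h _⟩
  rw [hG.subgroup_eq_top_of_swap_mem h]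
  exact Subgroup.mem_top π
end

section
/- Let n ≥ 1 and let G be a connected simple graph on Fin n with edge set E. Suppose ρ : ℝ → Matrix Q Q ℂ satisfies, for every t ∈ ℝ, HasDerivAt ρ (Σ_{{j,k} ∈ E} (U_{jk} * ρ(t) * U_{jk} − ρ(t))) t. Then there exist γ > 0 (independent of ρ) and C ≥ 0 such that ‖ρ(t) − P*(ρ(0))‖ ≤ C·e^{−γ t} for all t ≥ 0; in particular, ρ(t) converges to the quantum average P*(ρ(0)) as t → ∞. -/
open Matrix
attribute [local instance] Matrix.linftyOpNormedRing Matrix.linftyOpNormedAlgebra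
section AbstractConsensus

variable {E ι : Type*} [NormedAddCommGroup E] [InnerProductSpace ℝ E] [FiniteDimensional ℝ E]
  [Fintype ι] (U : ι → E →ₗᵢ[ℝ] E) (P : E →ₗ[ℝ] E)

/-- If every common fixed point of a finite family of isometries is fixed by `P`, then the
Dirichlet form of the family is coercive on the kernel of `P`. -/
theorem exists_norm_sq_le_sum_norm_sq_sub (hfix : ∀ x, (∀ i, U i x = x) → P x = x) :
    ∃ K > (0 : ℝ), ∀ x, P x = 0 → ‖x‖ ^ 2 ≤ K * ∑ i, ‖U i x - x‖ ^ 2 := by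
  let T : E →ₗ[ℝ] (ι → E) × E :=
    (LinearMap.pi fun i => (U i).toLinearMap - LinearMap.id).prod P
  have hT : LinearMap.ker T = ⊥ := by
    rw [LinearMap.ker_eq_bot']
    intro x hx
    obtain ⟨h1, h2⟩ := Prod.mk.inj hx
    rw [← hfix x fun i => sub_eq_zero.mp (congrFun h1 i)]
    exact h2
  obtain ⟨K, hK, hanti⟩ := T.exists_antilipschitzWith hT
  have hK' : (0 : ℝ) < K := hK
  refine ⟨(K : ℝ) ^ 2, by positivity, fun x hx => ?_⟩
  have h1 : ‖x‖ ≤ K * ‖T x‖ := by simpa using hanti.le_mul_dist x 0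
  have h2 : ‖T x‖ ≤ √(∑ i, ‖U i x - x‖ ^ 2) := by
    refine max_le ?_ ?_
    · refine (pi_norm_le_iff_of_nonneg (Real.sqrt_nonneg _)).2 fun i => ?_
      exact Real.le_sqrt_of_sq_le
        (Finset.single_le_sum (f := fun i => ‖U i x - x‖ ^ 2)
          (fun j _ => sq_nonneg _) (Finset.mem_univ i))
    · change ‖P x‖ ≤ _
      rw [hx, norm_zero]
      exact Real.sqrt_nonneg _
  calc ‖x‖ ^ 2 ≤ (K * √(∑ i, ‖U i x - x‖ ^ 2)) ^ 2 := by gcongr; exact h1.trans (by gcongr)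
    _ = (K : ℝ) ^ 2 * ∑ i, ‖U i x - x‖ ^ 2 := by
      rw [mul_pow, Real.sq_sqrt (Finset.sum_nonneg fun i _ => sq_nonneg _)]

/-- The flow of `∑ i, (U i - 1)` for isometries `U i` of a Euclidean space converges exponentially
to the invariant projection `P` of the initial value. -/
theorem exists_exponential_convergence_of_isometries
    (hfix : ∀ x, (∀ i, U i x = x) → P x = x) (hPU : ∀ i x, P (U i x) = P x)
    (hUP : ∀ i x, U i (P x) = P x) :
    ∃ γ > (0 : ℝ), ∀ x : ℝ → E, (∀ s, HasDerivAt x (∑ i, (U i (x s) - x s)) s) →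
      ∀ s ≥ (0 : ℝ), ‖x s - P (x 0)‖ ≤ ‖x 0 - P (x 0)‖ * Real.exp (-γ * s) := by
  obtain ⟨K, hK, hgap⟩ := exists_norm_sq_le_sum_norm_sq_sub U P hfix
  refine ⟨1 / (2 * K), by positivity, fun x hx s hs => ?_⟩
  have hconst : ∀ t, P (x t) = P (x 0) := by
    have hd : ∀ t, HasDerivAt (fun t => P (x t)) 0 t := fun t => by
      have h := P.toContinuousLinearMap.hasFDerivAt.comp_hasDerivAt t (hx t)
      simpa [Function.comp_def, hPU] using h
    exact fun t => is_const_of_deriv_eq_zero (fun t => (hd t).differentiableAt)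
      (fun t => (hd t).deriv) t 0
  set y : ℝ → E := fun t => x t - P (x 0) with hy
  have hyd : ∀ t, HasDerivAt y (∑ i, (U i (y t) - y t)) t := fun t => by
    simpa [hy, hUP] using (hx t).sub_const (P (x 0))
  have hPy : ∀ t, P (y t) = 0 := fun t => by
    simp [hy, hconst, hfix _ fun i => hUP i (x 0)]
  have hinner : ∀ i z, 2 * inner ℝ z (U i z - z) = -‖U i z - z‖ ^ 2 := fun i z => by
    rw [norm_sub_sq_real, inner_sub_right, real_inner_self_eq_norm_sq, LinearIsometry.norm_map,
      real_inner_comm]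
    ring
  have hV : ∀ t, HasDerivAt (fun t => ‖y t‖ ^ 2 * Real.exp (t / K))
      (-(∑ i, ‖U i (y t) - y t‖ ^ 2) * Real.exp (t / K)
        + ‖y t‖ ^ 2 * (Real.exp (t / K) * (1 / K))) t := fun t => by
    have h := (hyd t).norm_sq
    rw [inner_sum, Finset.mul_sum, Finset.sum_congr rfl fun i _ => hinner i (y t),
      Finset.sum_neg_distrib] at h
    exact h.mul ((hasDerivAt_id t).div_const K).exp
  have hanti : Antitone fun t => ‖y t‖ ^ 2 * Real.exp (t / K) := by
    refine antitone_of_deriv_nonpos (fun t => (hV t).differentiableAt) fun t => ?_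
    rw [(hV t).deriv]
    have h1 : ‖y t‖ ^ 2 * (1 / K) ≤ ∑ i, ‖U i (y t) - y t‖ ^ 2 := by
      rw [mul_one_div, div_le_iff₀' hK]
      exact hgap _ (hPy t)
    nlinarith [Real.exp_pos (t / K)]
  have hle : ‖y s‖ ^ 2 * Real.exp (s / K) ≤ ‖y 0‖ ^ 2 := by simpa using hanti hs
  refine (sq_le_sq₀ (norm_nonneg _) (by positivity)).1 ?_
  have he : Real.exp (-(1 / (2 * K)) * s) ^ 2 = (Real.exp (s / K))⁻¹ := by
    rw [← Real.exp_nat_mul, ← Real.exp_neg]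
    congr 1
    push_cast
    field_simp
  rw [mul_pow, he, ← div_eq_mul_inv, le_div_iff₀ (Real.exp_pos _)]
  exact hle

end AbstractConsensus

theorem LinearMap.exists_nonneg_norm_le_mul_norm {E F : Type*} [NormedAddCommGroup E]
    [NormedSpace ℝ E] [FiniteDimensional ℝ E] [NormedAddCommGroup F] [NormedSpace ℝ F]
    (T : E →ₗ[ℝ] F) : ∃ C ≥ (0 : ℝ), ∀ x, ‖T x‖ ≤ C * ‖x‖ :=
  ⟨‖T.toContinuousLinearMap‖, norm_nonneg _, T.toContinuousLinearMap.le_opNorm⟩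

section QuantumConsensus

variable {n : ℕ}

theorem permMat_mul_mul_conjTranspose (π : Equiv.Perm (Fin n)) (z : Matrix (Qn n) (Qn n) ℂ) :
    permMat π * z * (permMat π)ᴴ = z.submatrix (· ∘ π.symm) (· ∘ π.symm) := by
  have hiff : ∀ f h : Qn n, f = h ∘ π ↔ h = f ∘ π.symm := fun f h => by
    rw [Equiv.eq_comp_symm, eq_comm]
  ext f g
  simp [Matrix.mul_apply, permMat, hiff, apply_ite]

theorem uSwap_conjTranspose (j k : Fin n) : (uSwap j k)ᴴ = uSwap j k := by
  have hiff : ∀ f h : Qn n, f = h ∘ Equiv.swap j k ↔ h = f ∘ Equiv.swap j k := fun f h => by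
    rw [← Equiv.comp_symm_eq, Equiv.symm_swap, eq_comm]
  ext f g
  simp [uSwap, permMat, hiff g f, apply_ite]

theorem uSwap_mul_mul_uSwap (j k : Fin n) (z : Matrix (Qn n) (Qn n) ℂ) :
    uSwap j k * z * uSwap j k =
      z.submatrix (· ∘ Equiv.swap j k) (· ∘ Equiv.swap j k) := by
  have h := permMat_mul_mul_conjTranspose (Equiv.swap j k) z
  rw [← uSwap, uSwap_conjTranspose] at h
  simpa using h

theorem pStar_apply (z : Matrix (Qn n) (Qn n) ℂ) (f g : Qn n) :
    pStar z f g = (n.factorial : ℂ)⁻¹ * ∑ π : Equiv.Perm (Fin n), z (f ∘ π) (g ∘ π) := by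
  simp only [pStar, permMat_mul_mul_conjTranspose, Matrix.smul_apply, Matrix.sum_apply,
    Matrix.submatrix_apply, smul_eq_mul]
  congr 1
  exact Equiv.sum_comp (Equiv.inv (Equiv.Perm (Fin n))) fun π => z (f ∘ π) (g ∘ π)

theorem pStar_submatrix (σ : Equiv.Perm (Fin n)) (z : Matrix (Qn n) (Qn n) ℂ) :
    pStar (z.submatrix (· ∘ σ) (· ∘ σ)) = pStar z := by
  ext f g
  simp only [pStar_apply, Matrix.submatrix_apply]
  congr 1
  exact Equiv.sum_comp (Equiv.mulRight σ) fun π => z (f ∘ π) (g ∘ π)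

theorem submatrix_pStar (σ : Equiv.Perm (Fin n)) (z : Matrix (Qn n) (Qn n) ℂ) :
    (pStar z).submatrix (· ∘ σ) (· ∘ σ) = pStar z := by
  ext f g
  simp only [pStar_apply, Matrix.submatrix_apply]
  congr 1
  exact Equiv.sum_comp (Equiv.mulLeft σ) fun π => z (f ∘ π) (g ∘ π)

theorem SimpleGraph.Connected.mem_of_swap_mem {V : Type*} [DecidableEq V] [Finite V]
    {G : SimpleGraph V} (hG : G.Connected) (M : Submonoid (Equiv.Perm V))
    (hM : ∀ j k, G.Adj j k → Equiv.swap j k ∈ M) (π : Equiv.Perm V) : π ∈ M := by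
  have hswap : ∀ j k, Equiv.swap j k ∈ M := fun j k => by
    obtain ⟨w⟩ := hG.preconnected j k
    induction w with
    | nil => rw [Equiv.swap_self]; exact M.one_mem
    | cons h _ ih => exact SubmonoidClass.swap_mem_trans M (hM _ _ h) ih
  induction π using Equiv.Perm.swap_induction_on with
  | one => exact M.one_mem
  | swap_mul f x y _ ih => exact M.mul_mem (hswap x y) ih

theorem pStar_eq_self {G : SimpleGraph (Fin n)} (hG : G.Connected)
    {z : Matrix (Qn n) (Qn n) ℂ}
    (hz : ∀ j k, G.Adj j k → z.submatrix (· ∘ Equiv.swap j k) (· ∘ Equiv.swap j k) = z) :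
    pStar z = z := by
  let M : Submonoid (Equiv.Perm (Fin n)) :=
    { carrier := {π | ∀ f g, z (f ∘ π) (g ∘ π) = z f g}
      one_mem' := fun _ _ => rfl
      mul_mem' := fun {a b} ha hb f g => (hb (f ∘ a) (g ∘ a)).trans (ha f g) }
  have hM : ∀ (π : Equiv.Perm (Fin n)) f g, z (f ∘ π) (g ∘ π) = z f g :=
    hG.mem_of_swap_mem M fun j k h f g => congrFun₂ (hz j k h) f g
  ext f g
  have hfac : (n.factorial : ℂ) ≠ 0 := by exact_mod_cast n.factorial_ne_zero
  simp [pStar_apply, hM, Fintype.card_perm, hfac]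

/-- Matrices over the register, as a Euclidean space with the Hilbert–Schmidt norm. -/
noncomputable def matrixEuclideanEquiv (n : ℕ) :
    Matrix (Qn n) (Qn n) ℂ ≃ₗ[ℝ] EuclideanSpace ℂ (Qn n × Qn n) where
  toFun z := WithLp.toLp 2 fun p => z p.1 p.2
  invFun v := Matrix.of fun f g => v (f, g)
  map_add' _ _ := rfl
  map_smul' _ _ := rfl
  left_inv _ := rfl
  right_inv _ := rfl

/-- Simultaneous relabelling of the rows and columns of a matrix by a permutation of the qubits,
as an isometry for the Hilbert–Schmidt norm. -/
noncomputable def permIsometry (σ : Equiv.Perm (Fin n)) :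
    EuclideanSpace ℂ (Qn n × Qn n) →ₗᵢ[ℝ] EuclideanSpace ℂ (Qn n × Qn n) :=
  (LinearIsometryEquiv.piLpCongrLeft 2 ℝ ℂ
    ((σ.arrowCongr (Equiv.refl (Fin 2))).prodCongr
      (σ.arrowCongr (Equiv.refl (Fin 2))))).toLinearIsometry

theorem permIsometry_matrixEuclideanEquiv (σ : Equiv.Perm (Fin n))
    (z : Matrix (Qn n) (Qn n) ℂ) :
    permIsometry σ (matrixEuclideanEquiv n z) =
      matrixEuclideanEquiv n (z.submatrix (· ∘ σ) (· ∘ σ)) := rfl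

/-- The quantum average as a real-linear map. -/
noncomputable def pStarLinear (n : ℕ) :
    Matrix (Qn n) (Qn n) ℂ →ₗ[ℝ] Matrix (Qn n) (Qn n) ℂ where
  toFun := pStar
  map_add' x y := by
    simp [pStar, Matrix.mul_add, Matrix.add_mul, Finset.sum_add_distrib]
  map_smul' c x := by
    simp [pStar, ← Finset.smul_sum, smul_comm c]

end QuantumConsensus

/-- over a fixed connected quantum interaction graph, every global solution
of the quantum consensus master equation converges exponentially (with a rate `γ`
independent of the solution) to the quantum average `P*(ρ(0))` of its initial state. -/
theorem quantum_consensus_exponential_convergence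
    (n : ℕ) (hn : 1 ≤ n) (G : SimpleGraph (Fin n)) [DecidableRel G.Adj]
    (hG : G.Connected) :
    ∃ γ > (0 : ℝ), ∀ ρ : ℝ → Matrix (Qn n) (Qn n) ℂ,
      (∀ s : ℝ, HasDerivAt ρ
          (∑ p ∈ edgePairs G, (uSwap p.1 p.2 * ρ s * uSwap p.1 p.2 - ρ s)) s) →
      (∃ C ≥ (0 : ℝ), ∀ s ≥ (0 : ℝ),
          ‖ρ s - pStar (ρ 0)‖ ≤ C * Real.exp (-γ * s)) ∧
        Filter.Tendsto ρ Filter.atTop (nhds (pStar (ρ 0))) := by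
  let e := matrixEuclideanEquiv n
  let eL := e.toContinuousLinearEquiv
  let U : edgePairs G → _ := fun p => permIsometry (Equiv.swap p.1.1 p.1.2)
  let P := e.toLinearMap ∘ₗ pStarLinear n ∘ₗ e.symm.toLinearMap
  have hU : ∀ p z, U p (e z) = e (uSwap p.1.1 p.1.2 * z * uSwap p.1.1 p.1.2) := fun p z => by
    rw [uSwap_mul_mul_uSwap]
    exact permIsometry_matrixEuclideanEquiv _ z
  have hP : ∀ z, P (e z) = e (pStar z) := fun z => rfl
  obtain ⟨γ, hγ, hconv⟩ := exists_exponential_convergence_of_isometries U P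
    (fun x hx => by
      obtain ⟨z, rfl⟩ := e.surjective x
      rw [hP]
      congr 1
      have hz : ∀ p ∈ edgePairs G, z.submatrix (· ∘ Equiv.swap p.1 p.2)
          (· ∘ Equiv.swap p.1 p.2) = z := fun p hp => by
        rw [← uSwap_mul_mul_uSwap]
        exact e.injective ((hU ⟨p, hp⟩ z).symm.trans (hx ⟨p, hp⟩))
      refine pStar_eq_self hG fun j k hjk => ?_
      rcases hjk.ne.lt_or_gt with h | h
      · exact hz (j, k) (by simp [edgePairs, hjk, h])
      · rw [Equiv.swap_comm]
        exact hz (k, j) (by simp [edgePairs, hjk.symm, h]))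
    (fun p x => by
      obtain ⟨z, rfl⟩ := e.surjective x
      rw [hU, hP, hP, uSwap_mul_mul_uSwap, pStar_submatrix])
    (fun p x => by
      obtain ⟨z, rfl⟩ := e.surjective x
      rw [hP, hU, uSwap_mul_mul_uSwap, submatrix_pStar])
  refine ⟨γ, hγ, fun ρ hρ => ?_⟩
  have hflow : ∀ s, HasDerivAt (fun s => e (ρ s)) (∑ p, (U p (e (ρ s)) - e (ρ s))) s := fun s => by
    have h := eL.toContinuousLinearMap.hasFDerivAt.comp_hasDerivAt s (hρ s)
    refine h.congr_deriv ?_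
    change e _ = _
    simp only [hU, ← map_sub, ← map_sum]
    rw [← Finset.sum_coe_sort]
  obtain ⟨C, hC, hle⟩ := e.symm.toLinearMap.exists_nonneg_norm_le_mul_norm
  have hbound : ∀ s ≥ (0 : ℝ), ‖ρ s - pStar (ρ 0)‖ ≤
      C * ‖e (ρ 0) - e (pStar (ρ 0))‖ * Real.exp (-γ * s) :=
    fun s hs => by
    have h := hconv _ hflow s hs
    rw [hP] at h
    have h2 := hle (e (ρ s) - e (pStar (ρ 0)))
    rw [← map_sub, LinearEquiv.coe_coe, e.symm_apply_apply, map_sub] at h2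
    rw [mul_assoc]
    exact h2.trans (by gcongr)
  refine ⟨⟨_, by positivity, hbound⟩, ?_⟩
  refine tendsto_iff_norm_sub_tendsto_zero.2 <| squeeze_zero' (Filter.Eventually.of_forall fun _ => norm_nonneg _)
    ((Filter.eventually_ge_atTop 0).mono hbound) ?_
  have hlin : Filter.Tendsto (fun s : ℝ => -γ * s) Filter.atTop Filter.atBot :=
    Filter.tendsto_id.const_mul_atTop_of_neg (neg_lt_zero.2 hγ)
  simpa using (Real.tendsto_exp_atBot.comp hlin).const_mul
    (C * ‖e (ρ 0) - e (pStar (ρ 0))‖)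
end
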